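/- arXiv:2012.12700 — 3 statements merged into one kernel-verified Lean document; each statement's English description precedes it below -/
import Mathlib

section
/- Let U_A and U_B be 2×2 unitary complex matrices. There exist 2×2 complex matrices V_A and V_B such that CZ · (U_A ⊗ U_B) · CZ = V_A ⊗ V_B if and only if each of U_A and U_B is diagonal or antidiagonal. -/
open Matrix Kronecker

/-- The controlled-Z gate as a `4 × 4` matrix, `diag(1, 1, 1, -1)`,
indexed by pairs of qubit basis states. -/
noncomputable def CZ : Matrix (Fin 2 × Fin 2) (Fin 2 × Fin 2) ℂ :=
  Matrix.diagonal fun p => if p = (1, 1) then -1 else 1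

/-- A `2 × 2` matrix is diagonal when both off-diagonal entries vanish. -/
def IsDiagonal2 (M : Matrix (Fin 2) (Fin 2) ℂ) : Prop :=
  M 0 1 = 0 ∧ M 1 0 = 0

/-- A `2 × 2` matrix is antidiagonal when both diagonal entries vanish. -/
def IsAntidiag2 (M : Matrix (Fin 2) (Fin 2) ℂ) : Prop :=
  M 0 0 = 0 ∧ M 1 1 = 0

theorem CZ_mul_kronecker_mul_CZ_apply (A B : Matrix (Fin 2) (Fin 2) ℂ) (i j k l : Fin 2) :
    (CZ * (A ⊗ₖ B) * CZ) (i, j) (k, l) =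
      (if (i, j) = (1, 1) then -1 else 1) * (A i k * B j l) *
        (if (k, l) = (1, 1) then -1 else 1) := by
  simp only [CZ, Matrix.mul_diagonal, Matrix.diagonal_mul, Matrix.kroneckerMap_apply]

theorem exists_apply_ne_zero_of_mem_unitaryGroup {n : Type*} [Fintype n] [DecidableEq n]
    {U : Matrix n n ℂ} (hU : U ∈ Matrix.unitaryGroup n ℂ) (j : n) : ∃ i, U i j ≠ 0 := by
  by_contra! h
  have hjj := congrFun₂ (Matrix.mem_unitaryGroup_iff'.mp hU) j j
  simp [Matrix.mul_apply, h] at hjj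

theorem isDiagonal2_or_isAntidiag2_of_mul_eq_zero {U : Matrix (Fin 2) (Fin 2) ℂ}
    (hU : U ∈ Matrix.unitaryGroup (Fin 2) ℂ) (h : U 0 0 * U 0 1 = 0) :
    IsDiagonal2 U ∨ IsAntidiag2 U := by
  have h00 := congrFun₂ (Matrix.mem_unitaryGroup_iff.mp hU) 0 0
  have h01 := congrFun₂ (Matrix.mem_unitaryGroup_iff.mp hU) 0 1
  simp only [Matrix.mul_apply, Fin.sum_univ_two, Matrix.star_apply] at h00 h01
  rcases mul_eq_zero.mp h with h | h
  · have : U 0 1 ≠ 0 := fun h' => by simp [h, h'] at h00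
    exact Or.inr ⟨h, by simpa [h, this] using h01⟩
  · have : U 0 0 ≠ 0 := fun h' => by simp [h, h'] at h00
    exact Or.inl ⟨h, by simpa [h, this] using h01⟩

/-- The `2 × 2` minors of the realigned matrix vanish for a tensor product. -/
theorem kronecker_minor_eq {l m n p R : Type*} [CommSemiring R] (A : Matrix l m R)
    (B : Matrix n p R) (i i' : l) (k k' : m) (j j' : n) (q q' : p) :
    (A ⊗ₖ B) (i, j) (k, q) * (A ⊗ₖ B) (i', j') (k', q') =
      (A ⊗ₖ B) (i, j') (k, q') * (A ⊗ₖ B) (i', j) (k', q) := by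
  simp only [Matrix.kroneckerMap_apply]
  ring

/-- `CZ` conjugates `U_A ⊗ U_B` into some tensor product `V_A ⊗ V_B` if and
only if each of `U_A` and `U_B` is diagonal or antidiagonal. -/
theorem cz_conjugation_iff (UA UB : Matrix (Fin 2) (Fin 2) ℂ)
    (hA : UA ∈ Matrix.unitaryGroup (Fin 2) ℂ)
    (hB : UB ∈ Matrix.unitaryGroup (Fin 2) ℂ) :
    (∃ VA VB : Matrix (Fin 2) (Fin 2) ℂ, CZ * (UA ⊗ₖ UB) * CZ = VA ⊗ₖ VB) ↔
      ((IsDiagonal2 UA ∨ IsAntidiag2 UA) ∧ (IsDiagonal2 UB ∨ IsAntidiag2 UB)) := by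
  constructor
  · rintro ⟨VA, VB, h⟩
    have minor := kronecker_minor_eq VA VB
    simp only [← h, CZ_mul_kronecker_mul_CZ_apply] at minor
    constructor
    · apply isDiagonal2_or_isAntidiag2_of_mul_eq_zero hA
      obtain ⟨j, hj⟩ := exists_apply_ne_zero_of_mem_unitaryGroup hB 0
      obtain ⟨j', hj'⟩ := exists_apply_ne_zero_of_mem_unitaryGroup hB 1
      have key : -(UA 0 0 * UB j 0 * (UA 0 1 * UB j' 1)) =
          UA 0 0 * UB j' 1 * (UA 0 1 * UB j 0) := by
        simpa using minor 0 0 0 1 j j' 0 1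
      have : UA 0 0 * UA 0 1 * (UB j 0 * UB j' 1) = 0 := by linear_combination (-1 / 2) * key
      exact (mul_eq_zero.mp this).resolve_right (mul_ne_zero hj hj')
    · apply isDiagonal2_or_isAntidiag2_of_mul_eq_zero hB
      obtain ⟨i, hi⟩ := exists_apply_ne_zero_of_mem_unitaryGroup hA 0
      obtain ⟨i', hi'⟩ := exists_apply_ne_zero_of_mem_unitaryGroup hA 1
      have key : -(UA i 0 * UB 0 0 * (UA i' 1 * UB 0 1)) =
          UA i 0 * UB 0 1 * (UA i' 1 * UB 0 0) := by
        simpa using minor i i' 0 1 0 0 0 1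
      have : UB 0 0 * UB 0 1 * (UA i 0 * UA i' 1) = 0 := by linear_combination (-1 / 2) * key
      exact (mul_eq_zero.mp this).resolve_right (mul_ne_zero hi hi')
  · let Z : Matrix (Fin 2) (Fin 2) ℂ := Matrix.diagonal ![1, -1]
    rintro ⟨⟨hA₁, hA₂⟩ | ⟨hA₁, hA₂⟩, ⟨hB₁, hB₂⟩ | ⟨hB₁, hB₂⟩⟩
    on_goal 1 => refine ⟨UA, UB, ?_⟩
    on_goal 2 => refine ⟨Z * UA, UB, ?_⟩
    on_goal 3 => refine ⟨UA, Z * UB, ?_⟩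
    on_goal 4 => refine ⟨-(Z * UA), Z * UB, ?_⟩
    all_goals
      ext ⟨i, j⟩ ⟨k, l⟩
      rw [CZ_mul_kronecker_mul_CZ_apply]
      fin_cases i <;> fin_cases j <;> fin_cases k <;> fin_cases l <;>
        simp [Z, Matrix.diagonal_mul, hA₁, hA₂, hB₁, hB₂]
end

section
/- Let U_A and U_B be 2×2 complex matrices, each of which is diagonal or antidiagonal. Then there exist 2×2 complex matrices V_A and V_B such that CZ · (U_A ⊗ U_B) · CZ = V_A ⊗ V_B. -/
open Matrix Kronecker

/-- Conjugation by `CZ` multiplies each entry by the signs of its row and column. -/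
theorem CZ_mul_mul_CZ_apply (M : Matrix (Fin 2 × Fin 2) (Fin 2 × Fin 2) ℂ)
    (p q : Fin 2 × Fin 2) :
    (CZ * M * CZ) p q =
      (if p = (1, 1) then -1 else 1) * M p q * (if q = (1, 1) then -1 else 1) := by
  rw [CZ, Matrix.mul_diagonal, Matrix.diagonal_mul]

/-- (Sufficiency) If each of `U_A` and `U_B` is diagonal or antidiagonal,
then `CZ` conjugates `U_A ⊗ U_B` into some tensor product `V_A ⊗ V_B`. -/
theorem cz_conjugation_sufficiency (UA UB : Matrix (Fin 2) (Fin 2) ℂ)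
    (hA : IsDiagonal2 UA ∨ IsAntidiag2 UA)
    (hB : IsDiagonal2 UB ∨ IsAntidiag2 UB) :
    ∃ VA VB : Matrix (Fin 2) (Fin 2) ℂ, CZ * (UA ⊗ₖ UB) * CZ = VA ⊗ₖ VB := by
  rcases hA with ⟨hA₁, hA₂⟩ | ⟨hA₁, hA₂⟩ <;> rcases hB with ⟨hB₁, hB₂⟩ | ⟨hB₁, hB₂⟩
  on_goal 1 => refine ⟨UA, UB, ?_⟩
  on_goal 2 => refine ⟨UA * diagonal ![1, -1], UB, ?_⟩
  on_goal 3 => refine ⟨UA, UB * diagonal ![1, -1], ?_⟩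
  on_goal 4 => refine ⟨-(UA * diagonal ![1, -1]), UB * diagonal ![1, -1], ?_⟩
  all_goals
    ext ⟨i, k⟩ ⟨j, l⟩
    rw [CZ_mul_mul_CZ_apply]
    fin_cases i <;> fin_cases j <;> fin_cases k <;> fin_cases l <;>
      simp [hA₁, hA₂, hB₁, hB₂]
end

section
/- For all x, y ∈ {0, 1} and every real number α, (I ⊗ R_Z⁺(α)) · CZ_{xy} = CZ_{x(1−y)} · (I ⊗ R_Z⁺(α)), where I is the 2×2 identity matrix; that is, exchanging a generalized CZ gate with an antidiagonal gate on its second qubit toggles the corresponding bit of the generalized CZ gate. -/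
open Matrix Kronecker

/-- The generalized controlled-Z gate `CZ_{xy}`: the `4 × 4` diagonal matrix
whose entry at basis state `|ab⟩` is `(-1)^(δ_{ax} δ_{by})`. -/
noncomputable def CZg (x y : Fin 2) : Matrix (Fin 2 × Fin 2) (Fin 2 × Fin 2) ℂ :=
  Matrix.diagonal fun p => if p.1 = x ∧ p.2 = y then -1 else 1

/-- The antidiagonal rotation `R_Z⁺(α) = X · R_Z(α)`. -/
noncomputable def RZplus (α : ℝ) : Matrix (Fin 2) (Fin 2) ℂ :=
  !![0, Complex.exp ((α : ℂ) / 2 * Complex.I);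
     Complex.exp (-((α : ℂ) / 2) * Complex.I), 0]

/-- Exchanging a generalized `CZ` gate with an antidiagonal gate `R_Z⁺(α)` on
its second qubit toggles the corresponding bit:
`(I ⊗ R_Z⁺(α)) · CZ_{xy} = CZ_{x(1-y)} · (I ⊗ R_Z⁺(α))`. -/
theorem rzplus_exchanges_generalized_cz (x y : Fin 2) (α : ℝ) :
    ((1 : Matrix (Fin 2) (Fin 2) ℂ) ⊗ₖ RZplus α) * CZg x y =
      CZg x (1 - y) * ((1 : Matrix (Fin 2) (Fin 2) ℂ) ⊗ₖ RZplus α) := by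
  ext ⟨a, b⟩ ⟨c, d⟩
  rw [CZg, CZg, Matrix.mul_diagonal, Matrix.diagonal_mul, Matrix.kroneckerMap_apply]
  rcases eq_or_ne a c with rfl | hac
  · fin_cases b <;> fin_cases d <;> fin_cases y <;> simp [RZplus]
  · simp [Matrix.one_apply_ne hac]
end
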